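/- arXiv:2011.05676 — 5 statements merged into one kernel-verified Lean document; each statement's English description precedes it below -/
import Mathlib

section
/- Let w ≥ 0 be a real number and r ∈ ℕ. Suppose segments are organized into groups G_1,…,G_m, where group G_a consists of consecutive half-open intervals [e_{a,0},e_{a,1}), [e_{a,1},e_{a,2}), …, [e_{a,k_a−1},e_{a,k_a}) with naturals r ≤ e_{a,0} < e_{a,1} < ⋯ < e_{a,k_a}, and every right endpoint occurring in group G_a is at most every left endpoint occurring in group G_{a+1} (later groups lie entirely to the right of earlier ones). The cost of the first interval of group G_a is w·(e_{a,1} − r), and the cost of its i-th interval for i ≥ 2 is w·(e_{a,i} − e_{a,i−1}). Suppose a nonempty selection of intervals picks from each group a (possibly empty) prefix of its intervals, and let e* be the maximum right endpoint among selected intervals. Then the total cost of the selected intervals is at least w·(e* − r). -/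
/-- Segments of a job with release time `r` and weight `w ≥ 0` are organized into
`m` groups; group `a` consists of the consecutive half-open intervals
`[e a 0, e a 1), [e a 1, e a 2), …, [e a (k a - 1), e a (k a))` with
`r ≤ e a 0 < e a 1 < ⋯ < e a (k a)`, and later groups lie entirely to the right
of earlier ones.  The first interval of a group costs `w·(e a 1 − r)` and the
`i`-th interval (`i ≥ 2`) costs `w·(e a i − e a (i−1))`.  If a nonempty
selection picks a prefix `sel a` of the intervals of each group, and
`e a₀ (sel a₀)` is the maximum right endpoint among selected intervals, then
the total cost of the selection is at least `w·(e a₀ (sel a₀) − r)`. -/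
theorem prefix_selection_cost_lower_bound
    (w : ℝ) (hw : 0 ≤ w) (r : ℕ) (m : ℕ) (e : ℕ → ℕ → ℕ) (k : ℕ → ℕ)
    (hk : ∀ a < m, 1 ≤ k a)
    (hr : ∀ a < m, r ≤ e a 0)
    (hmono : ∀ a < m, ∀ i < k a, e a i < e a (i + 1))
    (horder : ∀ a : ℕ, a + 1 < m → e a (k a) ≤ e (a + 1) 0)
    (sel : ℕ → ℕ) (hsel : ∀ a < m, sel a ≤ k a)
    (a₀ : ℕ) (ha₀ : a₀ < m) (hsel₀ : 1 ≤ sel a₀)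
    (hmax : ∀ a < m, 1 ≤ sel a → e a (sel a) ≤ e a₀ (sel a₀)) :
    w * ((e a₀ (sel a₀) : ℝ) - (r : ℝ)) ≤
      ∑ a ∈ Finset.range m,
        (if 1 ≤ sel a then
          w * ((e a 1 : ℝ) - (r : ℝ)) +
            ∑ i ∈ Finset.Icc 2 (sel a), w * ((e a i : ℝ) - (e a (i - 1) : ℝ))
        else 0) := by
  have htel : ∀ a n : ℕ, w * ((e a 1 : ℝ) - (r : ℝ)) +
      ∑ i ∈ Finset.Icc 2 (n + 1), w * ((e a i : ℝ) - (e a (i - 1) : ℝ))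
        = w * ((e a (n + 1) : ℝ) - (r : ℝ)) := by
    intro a n
    induction n with
    | zero => simp
    | succ n ih =>
      rw [Finset.sum_Icc_succ_top (by omega), ← add_assoc, ih]
      simp only [Nat.add_sub_cancel]
      ring
  have hle : ∀ a < m, ∀ n ≤ k a, r ≤ e a n := by
    intro a ha n
    induction n with
    | zero => intro _; exact hr a ha
    | succ n ih =>
      intro h
      have h1 := ih (by omega)
      have h2 := hmono a ha n (by omega)
      omega
  have hterm : ∀ a, 1 ≤ sel a → w * ((e a 1 : ℝ) - (r : ℝ)) +
      ∑ i ∈ Finset.Icc 2 (sel a), w * ((e a i : ℝ) - (e a (i - 1) : ℝ))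
        = w * ((e a (sel a) : ℝ) - (r : ℝ)) := by
    intro a h
    have := htel a (sel a - 1)
    rwa [Nat.sub_add_cancel h] at this
  have hnn : ∀ a ∈ Finset.range m, 0 ≤ (if 1 ≤ sel a then
          w * ((e a 1 : ℝ) - (r : ℝ)) +
            ∑ i ∈ Finset.Icc 2 (sel a), w * ((e a i : ℝ) - (e a (i - 1) : ℝ))
        else 0) := by
    intro a ha
    have ha := Finset.mem_range.mp ha
    split_ifs with h
    · rw [hterm a h]
      have : (r : ℝ) ≤ e a (sel a) := by exact_mod_cast hle a ha _ (hsel a ha)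
      exact mul_nonneg hw (sub_nonneg.mpr this)
    · exact le_rfl
  have := Finset.single_le_sum hnn (Finset.mem_range.mpr ha₀)
  rw [if_pos hsel₀, hterm a₀ hsel₀] at this
  exact this
end

section
/- Let n ≥ 1 be a natural number, set q := 2n (so that q = 2/ε for ε = 1/n), and let F be a real number with F ≥ 1. Then the number of indices i ∈ {0,1,…,n−1} for which there exists an integer k with q^{i+kn−1} ≤ F ≤ q^{i+kn+1} is at most 3. (Equivalently: if the offset off_y is chosen uniformly at random from {q^0, q^1, …, q^{n−1}} and K := q^n, then with probability at least 1 − 3/n there is no k ∈ ℤ with (1/q)·off_y·K^k ≤ F ≤ q·off_y·K^k.) -/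
open Classical

/-- Let `n ≥ 1`, set `q := 2n` (so `q = 2/ε` for `ε = 1/n`), and let `F ≥ 1` be a
real number.  The number of indices `i ∈ {0,…,n−1}` for which there exists an
integer `k` with `q^(i+kn−1) ≤ F ≤ q^(i+kn+1)` is at most `3`.  (Equivalently,
choosing the offset uniformly among `q^0,…,q^(n−1)`, the bad event
`ε/2·off_y·K^k ≤ F ≤ 2/ε·off_y·K^k` for some `k ∈ ℤ`, with `K = q^n`, has
probability at most `3/n`.) -/
theorem bad_offset_count_le_three
    (n : ℕ) (hn : 1 ≤ n) (F : ℝ) (hF : 1 ≤ F) :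
    ((Finset.range n).filter (fun i => ∃ k : ℤ,
        (2 * (n : ℝ)) ^ ((i : ℤ) + k * (n : ℤ) - 1) ≤ F ∧
          F ≤ (2 * (n : ℝ)) ^ ((i : ℤ) + k * (n : ℤ) + 1))).card ≤ 3 := by
  have hn' : (1 : ℝ) ≤ n := by exact_mod_cast hn
  have hq : (1 : ℝ) < 2 * (n : ℝ) := by linarith
  obtain ⟨m, hm1, hm2⟩ := exists_mem_Ico_zpow (lt_of_lt_of_le one_pos hF) hq
  have hc : ((Finset.Icc (m - 1) (m + 1)).image (fun j : ℤ => j % (n : ℤ))).card ≤ 3 := by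
    refine Finset.card_image_le.trans ?_
    rw [Int.card_Icc]; omega
  refine le_trans (Finset.card_le_card ?_) hc
  intro i hi
  obtain ⟨hin, k, h1, h2⟩ := Finset.mem_filter.mp hi
  have hin : ∃ a : ℕ, a < n ∧ (a : ℤ) = i := by
    simpa [Finset.bind_def, Finset.pure_def, eq_comm] using hin
  obtain ⟨c, hc1, hc2⟩ := hin
  have a := (zpow_lt_zpow_iff_right₀ hq).mp (lt_of_le_of_lt h1 hm2)
  have b := (zpow_le_zpow_iff_right₀ hq).mp (le_trans hm1 h2)
  refine Finset.mem_image.mpr ⟨i + k * (n : ℤ), Finset.mem_Icc.mpr ⟨by linarith, by linarith⟩, ?_⟩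
  show (i + k * (n : ℤ)) % (n : ℤ) = i
  rw [Int.add_mul_emod_self_right, Int.emod_eq_of_lt (by omega) (by omega)]
end

section
/- Let V be a finite set, B : V → ℝ with B ≥ 0, let anc : V → V → Prop be a relation (u is an ancestor of v) and d : V → V → ℕ a distance function such that d(u,v) ≥ 1 whenever anc u v, and such that for every u ∈ V and every i ≥ 1 the number of v ∈ V with anc u v and d(u,v) = i is at most K^i, where K ≥ 1 is a natural number. Then for every real ε with 0 < ε ≤ 1/2: Σ_{v ∈ V} Σ_{u : anc u v} B(u)·(ε/K)^{d(u,v)} ≤ 2ε · Σ_{u ∈ V} B(u). -/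
open Classical

/-- Let `V` be a finite set, `B : V → ℝ` nonnegative, `anc u v` an ancestor
relation with distance function `d` satisfying `d u v ≥ 1` whenever
`anc u v`, and suppose each `u` has at most `K^i` descendants at distance `i`
(for every `i ≥ 1`), where `K ≥ 1`.  Then for every `0 < ε ≤ 1/2`, the total
donated budget satisfies
`Σ_v Σ_{u : anc u v} B u · (ε/K)^(d u v) ≤ 2ε · Σ_u B u`. -/
theorem donated_budget_le
    {V : Type*} [Fintype V] (B : V → ℝ) (hB : ∀ v, 0 ≤ B v)
    (anc : V → V → Prop) (d : V → V → ℕ) (K : ℕ) (hK : 1 ≤ K)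
    (hd : ∀ u v, anc u v → 1 ≤ d u v)
    (hcount : ∀ u : V, ∀ i : ℕ, 1 ≤ i →
      (Finset.univ.filter (fun v => anc u v ∧ d u v = i)).card ≤ K ^ i)
    (ε : ℝ) (hε : 0 < ε) (hε2 : ε ≤ 1 / 2) :
    ∑ v : V, ∑ u ∈ Finset.univ.filter (fun u => anc u v),
        B u * (ε / (K : ℝ)) ^ (d u v)
      ≤ 2 * ε * ∑ u : V, B u := by
  have hK0 : (0 : ℝ) < K := by exact_mod_cast hK
  have geo : ∀ n : ℕ, ∑ i ∈ Finset.range n, ε ^ (i + 1) + 2 * ε ^ (n + 1) ≤ 2 * ε := by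
    intro n
    induction n with
    | zero => simp
    | succ n ih =>
      rw [Finset.sum_range_succ]
      have h1 : 0 < ε ^ (n + 1) := by positivity
      have h2 : ε ^ (n + 1 + 1) = ε ^ (n + 1) * ε := pow_succ _ _
      nlinarith
  have key : ∀ u : V, ∑ v ∈ Finset.univ.filter (fun v => anc u v),
      (ε / (K : ℝ)) ^ (d u v) ≤ 2 * ε := by
    intro u
    have hmaps : ∀ v ∈ Finset.univ.filter (fun v => anc u v),
        d u v - 1 ∈ Finset.range (Finset.univ.sup (d u) + 1) := by
      intro v _
      have := Finset.le_sup (f := d u) (Finset.mem_univ v)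
      rw [Finset.mem_range]
      omega
    rw [← Finset.sum_fiberwise_of_maps_to hmaps]
    refine le_trans (Finset.sum_le_sum (g := fun i => ε ^ (i + 1)) ?_) ?_
    · intro i _
      have hset : (Finset.univ.filter (fun v => anc u v)).filter (fun v => d u v - 1 = i)
          = Finset.univ.filter (fun v => anc u v ∧ d u v = i + 1) := by
        ext v
        simp only [Finset.mem_filter, Finset.mem_univ, true_and]
        constructor
        · rintro ⟨h, h'⟩
          have := hd u v h
          exact ⟨h, by omega⟩
        · rintro ⟨h, h'⟩
          exact ⟨h, by omega⟩
      rw [hset]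
      have hc : ∑ v ∈ Finset.univ.filter (fun v => anc u v ∧ d u v = i + 1),
          (ε / (K : ℝ)) ^ (d u v)
          = ((Finset.univ.filter (fun v => anc u v ∧ d u v = i + 1)).card : ℝ)
            * (ε / (K : ℝ)) ^ (i + 1) := by
        rw [← nsmul_eq_mul, ← Finset.sum_const]
        refine Finset.sum_congr rfl fun v hv => ?_
        rw [(Finset.mem_filter.mp hv).2.2]
      rw [hc]
      have hcard : ((Finset.univ.filter (fun v => anc u v ∧ d u v = i + 1)).card : ℝ)
          ≤ (K : ℝ) ^ (i + 1) := by exact_mod_cast hcount u (i + 1) (by omega)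
      calc _ ≤ (K : ℝ) ^ (i + 1) * (ε / (K : ℝ)) ^ (i + 1) :=
            mul_le_mul_of_nonneg_right hcard (by positivity)
        _ = ε ^ (i + 1) := by
            rw [← mul_pow, mul_div_cancel₀ _ hK0.ne']
    · have h1 := geo (Finset.univ.sup (d u) + 1)
      have h2 : 0 < ε ^ (Finset.univ.sup (d u) + 1 + 1) := by positivity
      linarith
  have hswap : ∑ v : V, ∑ u ∈ Finset.univ.filter (fun u => anc u v),
        B u * (ε / (K : ℝ)) ^ (d u v)
      = ∑ u : V, B u * ∑ v ∈ Finset.univ.filter (fun v => anc u v),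
        (ε / (K : ℝ)) ^ (d u v) := by
    simp only [Finset.mul_sum, Finset.sum_filter, mul_ite, mul_zero]
    rw [Finset.sum_comm]
  rw [hswap, Finset.mul_sum]
  refine Finset.sum_le_sum fun u _ => ?_
  rw [mul_comm (2 * ε)]
  exact mul_le_mul_of_nonneg_left (key u) (hB u)
end

section
/- Let K ≥ 1 be a natural number, let ε be a real with 0 < ε ≤ 1, let M ≥ 0 be real, and let a_0, a_1, …, a_k be nonnegative reals. Define b_i := (ε/(4K^8))^{i+1}·M + Σ_{j=0}^{i} (ε/4)^{i−j}·a_j for i = 0,…,k. Then: (1) b_i ≥ a_i for every i; (2) Σ_{i=0}^{k} b_i ≤ (ε/(2K^8))·M + (1 + ε/2)·Σ_{i=0}^{k} a_i; and (3) b_{i+1} ≥ (ε/(4K^8))·b_i for every i < k. -/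
/-- The smoothed budgets
`b i = (ε/(4K^8))^(i+1)·M + Σ_{j=0}^{i} (ε/4)^(i−j)·a j`. -/
noncomputable def smoothB (K : ℕ) (ε M : ℝ) (a : ℕ → ℝ) (i : ℕ) : ℝ :=
  (ε / (4 * (K : ℝ) ^ 8)) ^ (i + 1) * M +
    ∑ j ∈ Finset.range (i + 1), (ε / 4) ^ (i - j) * a j

lemma smoothAux_succ (q : ℝ) (a : ℕ → ℝ) (i : ℕ) :
    ∑ j ∈ Finset.range (i + 1 + 1), q ^ (i + 1 - j) * a j =
      q * (∑ j ∈ Finset.range (i + 1), q ^ (i - j) * a j) + a (i + 1) := by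
  rw [Finset.sum_range_succ, Finset.mul_sum]
  congr 1
  · apply Finset.sum_congr rfl
    intro j hj
    have : j ≤ i := by have := Finset.mem_range.1 hj; omega
    rw [Nat.sub_add_comm this, pow_succ]
    ring
  · simp

/-- For `K ≥ 1`, `0 < ε ≤ 1`, `M ≥ 0` and nonnegative reals `a 0, …, a k`, the
smoothed budgets `b i := smoothB K ε M a i` satisfy:
(1) `b i ≥ a i` for all `i ≤ k`;
(2) `Σ_{i=0}^{k} b i ≤ (ε/(2K^8))·M + (1 + ε/2)·Σ_{i=0}^{k} a i`; and
(3) `b (i+1) ≥ (ε/(4K^8))·b i` for all `i < k`. -/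
theorem smoothB_properties
    (K : ℕ) (hK : 1 ≤ K) (ε : ℝ) (hε : 0 < ε) (hε1 : ε ≤ 1)
    (M : ℝ) (hM : 0 ≤ M) (k : ℕ) (a : ℕ → ℝ) (ha : ∀ i ≤ k, 0 ≤ a i) :
    (∀ i ≤ k, a i ≤ smoothB K ε M a i) ∧
    (∑ i ∈ Finset.range (k + 1), smoothB K ε M a i ≤
      ε / (2 * (K : ℝ) ^ 8) * M + (1 + ε / 2) * ∑ i ∈ Finset.range (k + 1), a i) ∧
    (∀ i < k, ε / (4 * (K : ℝ) ^ 8) * smoothB K ε M a i ≤ smoothB K ε M a (i + 1)) := by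
  have hK8 : (1 : ℝ) ≤ (K : ℝ) ^ 8 := one_le_pow₀ (by exact_mod_cast hK)
  have hp2 : ε / (2 * (K : ℝ) ^ 8) = 2 * (ε / (4 * (K : ℝ) ^ 8)) := by
    field_simp; norm_num
  have hpq : ε / (4 * (K : ℝ) ^ 8) ≤ ε / 4 := by
    apply div_le_div_of_nonneg_left hε.le (by norm_num); linarith
  have hp0 : 0 < ε / (4 * (K : ℝ) ^ 8) := by positivity
  have hq4 : ε / 4 ≤ 1 / 4 := by linarith
  have he : ε / 2 = 2 * (ε / 4) := by ring
  rw [hp2, he]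
  unfold smoothB
  generalize ε / (4 * (K : ℝ) ^ 8) = p at *
  generalize ε / 4 = q at *
  have hq0 : 0 < q := lt_of_lt_of_le hp0 hpq
  obtain ⟨A, hA⟩ : ∃ A : ℕ → ℝ, ∀ i, A i = ∑ j ∈ Finset.range (i + 1), q ^ (i - j) * a j :=
    ⟨_, fun _ => rfl⟩
  have hA0 : A 0 = a 0 := by simp [hA]
  have hAs : ∀ i, A (i + 1) = q * A i + a (i + 1) := fun i => by
    rw [hA, hA]; exact smoothAux_succ q a i
  simp only [← hA]
  have hAn : ∀ i ≤ k, 0 ≤ A i := by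
    intro i hi
    induction i with
    | zero => rw [hA0]; exact ha 0 hi
    | succ n ih =>
      rw [hAs]
      have := ih (by omega)
      have := ha _ hi
      positivity
  refine ⟨?_, ?_, ?_⟩
  · intro i hi
    have h1 : 0 ≤ p ^ (i + 1) * M := by positivity
    cases i with
    | zero => rw [hA0]; linarith
    | succ n =>
      rw [hAs]
      have := mul_nonneg hq0.le (hAn n (by omega))
      linarith
  · have h1 : ∀ n, ∑ i ∈ Finset.range (n + 1), p ^ (i + 1) * M ≤ (2 * p - p ^ (n + 1)) * M := by
      intro n
      induction n with
      | zero => simp; linarith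
      | succ n ih =>
        rw [Finset.sum_range_succ]
        have h3 : 0 ≤ p ^ (n + 1) * M := by positivity
        have h4 : p ^ (n + 1 + 1) * M = p * (p ^ (n + 1) * M) := by ring
        nlinarith
    have h2 : ∀ n ≤ k, ∑ i ∈ Finset.range (n + 1), A i + 2 * q * A n ≤
        (1 + 2 * q) * ∑ i ∈ Finset.range (n + 1), a i := by
      intro n hn
      induction n with
      | zero => simp [hA0]; linarith
      | succ n ih =>
        have ih := ih (by omega)
        rw [Finset.sum_range_succ, Finset.sum_range_succ (f := a), hAs]
        have h3 := mul_nonneg hq0.le (hAn n (by omega))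
        nlinarith
    rw [Finset.sum_add_distrib]
    have h3 := h1 k
    have h4 := h2 k le_rfl
    have h5 : 0 ≤ p ^ (k + 1) * M := by positivity
    have h6 := mul_nonneg hq0.le (hAn k le_rfl)
    linarith
  · intro i hi
    rw [hAs]
    have h1 := mul_le_mul_of_nonneg_right hpq (hAn i hi.le)
    have h2 := ha (i + 1) hi
    have h4 : p ^ (i + 1 + 1) * M = p * (p ^ (i + 1) * M) := by ring
    linarith
end

section
/- Let J be a finite set of jobs with release times r_j ∈ ℕ, processing times p_j ∈ ℕ, and deadlines D_j ∈ ℕ with r_j ≤ D_j. Suppose that for all naturals s ≤ t: Σ over j ∈ J with s ≤ r_j and D_j ≤ t of p_j, is at most t − s. Then there exist pairwise disjoint finite sets A_j ⊆ ℕ with A_j ⊆ [r_j, D_j) and |A_j| = p_j for every j ∈ J; that is, there is a preemptive unit-slot schedule on a single machine in which every job j is processed for p_j time slots after its release r_j and completes by its deadline D_j. -/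
theorem hall_aux {ι : Type*} (J : Finset ι) (r p D : ι → ℕ)
    (hrD : ∀ j ∈ J, r j ≤ D j)
    (h : ∀ s t : ℕ, s ≤ t →
      ∑ j ∈ J.filter (fun j => s ≤ r j ∧ D j ≤ t), p j ≤ t - s) (K : Finset ι) (hK : K ⊆ J) :
    ∑ j ∈ K, p j ≤ (K.biUnion (fun j => Finset.Ico (r j) (D j))).card := by
  classical
  induction K using Finset.strongInduction with
  | H K ih =>
  rcases K.eq_empty_or_nonempty with rfl | hne
  · simp
  obtain ⟨m, hm, hmin⟩ := K.exists_min_image r hne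
  set U := K.biUnion (fun j => Finset.Ico (r j) (D j)) with hU
  have hex : ∃ b, r m ≤ b ∧ b ∉ U := by
    obtain ⟨b, hb⟩ := Infinite.exists_notMem_finset (U ∪ Finset.range (r m))
    simp only [Finset.mem_union, Finset.mem_range, not_or, not_lt] at hb
    exact ⟨b, hb.2, hb.1⟩
  obtain ⟨hb1, hb2⟩ := Nat.find_spec hex
  have hb3 : ∀ c, r m ≤ c → c < Nat.find hex → c ∈ U := by
    intro c hc hlt
    have := Nat.find_min hex hlt
    by_contra hcU
    exact this ⟨hc, hcU⟩
  generalize Nat.find hex = b at hb1 hb2 hb3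
  have hd : ∀ j ∈ K, D j ≤ b ∨ b < r j := by
    intro j hj
    by_contra hcon
    push Not at hcon
    exact hb2 (Finset.mem_biUnion.2 ⟨j, hj, Finset.mem_Ico.2 ⟨hcon.2, hcon.1⟩⟩)
  have hmD : ¬ b < r m := by omega
  have hss : K.filter (fun j => b < r j) ⊂ K :=
    Finset.filter_ssubset.2 ⟨m, hm, hmD⟩
  have h2 := ih _ hss (hss.subset.trans hK)
  have h1 : ∑ j ∈ K.filter (fun j => ¬ b < r j), p j ≤ b - r m := by
    refine le_trans (Finset.sum_le_sum_of_subset ?_) (h (r m) b hb1)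
    intro j hj
    rw [Finset.mem_filter] at hj ⊢
    exact ⟨hK hj.1, hmin j hj.1, (hd j hj.1).resolve_right hj.2⟩
  rw [← Finset.sum_filter_add_sum_filter_not K (fun j => b < r j)]
  refine (add_le_add h2 h1).trans ?_
  rw [← Nat.card_Ico, ← Finset.card_union_of_disjoint]
  · apply Finset.card_le_card
    apply Finset.union_subset
    · exact Finset.biUnion_subset_biUnion_of_subset_left _ hss.subset
    · intro c hc
      rw [Finset.mem_Ico] at hc
      exact hb3 c hc.1 hc.2
  · rw [Finset.disjoint_left]
    intro c hc hc'
    simp only [Finset.mem_biUnion, Finset.mem_filter, Finset.mem_Ico] at hc hc'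
    obtain ⟨j, hj, hj'⟩ := hc
    omega

/-- (Schedulability of a feasible (IP) solution.)  Let `J` be a finite set of jobs
with release times `r j`, processing times `p j`, and deadlines `D j ≥ r j`.
If for all naturals `s ≤ t` the total processing time of the jobs `j` with
`s ≤ r j` and `D j ≤ t` is at most `t − s`, then there is a preemptive
unit-slot schedule: pairwise disjoint finite sets `A j ⊆ [r j, D j)` of time
slots with `|A j| = p j` for every job `j`. -/
theorem feasible_IP_schedulable
    {ι : Type*} (J : Finset ι) (r p D : ι → ℕ)
    (hrD : ∀ j ∈ J, r j ≤ D j)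
    (h : ∀ s t : ℕ, s ≤ t →
      ∑ j ∈ J.filter (fun j => s ≤ r j ∧ D j ≤ t), p j ≤ t - s) :
    ∃ A : ι → Finset ℕ,
      (∀ j ∈ J, A j ⊆ Finset.Ico (r j) (D j)) ∧
      (∀ j ∈ J, (A j).card = p j) ∧
      (∀ j ∈ J, ∀ j' ∈ J, j ≠ j' → Disjoint (A j) (A j')) := by
  classical
  let T := J.sigma (fun j => Finset.range (p j))
  have hall : ∀ s : Finset T, s.card ≤
      (s.biUnion (fun x => Finset.Ico (r x.1.1) (D x.1.1))).card := by
    intro s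
    have hT : ∀ x : T, x.1.1 ∈ J ∧ x.1.2 < p x.1.1 := by
      intro x
      have hx := Finset.mem_sigma.1 x.2
      exact ⟨hx.1, Finset.mem_range.1 hx.2⟩
    have h1 := hall_aux J r p D hrD h (s.image (fun x => x.1.1)) (by
      intro j hj
      obtain ⟨x, _, rfl⟩ := Finset.mem_image.1 hj
      exact (hT x).1)
    rw [Finset.image_biUnion] at h1
    refine le_trans ?_ h1
    have h2 : s.map (Function.Embedding.subtype _) ⊆
        (s.image (fun x => x.1.1)).sigma (fun j => Finset.range (p j)) := by
      intro y hy
      obtain ⟨x, hx, rfl⟩ := Finset.mem_map.1 hy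
      exact Finset.mem_sigma.2 ⟨Finset.mem_image_of_mem _ hx, Finset.mem_range.2 (hT x).2⟩
    have h3 := Finset.card_le_card h2
    simpa [Finset.card_sigma] using h3
  obtain ⟨f, hf, hf'⟩ := (Finset.all_card_le_biUnion_card_iff_exists_injective
    (fun x : T => Finset.Ico (r x.1.1) (D x.1.1))).1 hall
  refine ⟨fun j => (T.attach.filter (fun x => x.1.1 = j)).image f, ?_, ?_, ?_⟩
  · intro j _ c hc
    obtain ⟨x, hx, rfl⟩ := Finset.mem_image.1 hc
    have := hf' x
    rwa [(Finset.mem_filter.1 hx).2] at this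
  · intro j hj
    rw [Finset.card_image_of_injective _ hf]
    symm
    rw [← Finset.card_range (p j)]
    refine Finset.card_bij
      (fun i hi => ⟨⟨j, i⟩, Finset.mem_sigma.2 ⟨hj, hi⟩⟩) ?_ ?_ ?_
    · intro i hi
      simp
    · intro i hi i' hi' he
      simpa using he
    · rintro ⟨⟨j', i⟩, hx⟩ hb
      have hjj : j' = j := (Finset.mem_filter.1 hb).2
      subst hjj
      exact ⟨i, (Finset.mem_sigma.1 hx).2, rfl⟩
  · intro j _ j' _ hne
    rw [Finset.disjoint_left]
    intro c hc hc'
    obtain ⟨x, hx, rfl⟩ := Finset.mem_image.1 hc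
    obtain ⟨y, hy, hxy⟩ := Finset.mem_image.1 hc'
    have := hf hxy
    subst this
    exact hne ((Finset.mem_filter.1 hx).2.symm.trans (Finset.mem_filter.1 hy).2)
end
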